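/- For all integers n ≥ 1 and k ≥ 0, ĉ_{n,k} = (n−1) · ĉ_{n−1,k} + Σ_{i=0}^{k} C(k,i) · ĉ_{n−1, k−i}, where C(k,i) denotes the binomial coefficient. -/

import Mathlib

/-- Unsigned Stirling numbers of the first kind:
`c(0,0)=1`, `c(n,m)=0` for `m>n` or (`n>0` and `m=0`), and `c(n+1,m)=n*c(n,m)+c(n,m-1)`. -/
def stirling1 : ℕ → ℕ → ℕ
  | 0, 0 => 1
  | 0, _ + 1 => 0
  | _ + 1, 0 => 0
  | n + 1, m + 1 => n * stirling1 n (m + 1) + stirling1 n m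

/-- Stirling numbers of the second kind:
`S(0,0)=1`, `S(n,m)=0` for `m>n` or (`n>0` and `m=0`), and `S(n+1,m)=m*S(n,m)+S(n,m-1)`. -/
def stirling2 : ℕ → ℕ → ℕ
  | 0, 0 => 1
  | 0, _ + 1 => 0
  | _ + 1, 0 => 0
  | n + 1, m + 1 => (m + 1) * stirling2 n (m + 1) + stirling2 n m

/-- Poly-Cauchy numbers of the second kind (negated upper index, unsigned):
`ĉ_{n,k} = Σ_{m=0}^n c(n,m)·(m+1)^k`. -/
def polyCauchy (n k : ℕ) : ℕ := ∑ m ∈ Finset.range (n + 1), stirling1 n m * (m + 1) ^ k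

theorem stirling1_eq_zero_of_lt : ∀ {n m : ℕ}, n < m → stirling1 n m = 0
  | 0, _ + 1, _ => by rw [stirling1]
  | n + 1, m + 1, h => by
    rw [stirling1, stirling1_eq_zero_of_lt (by omega : n < m + 1),
      stirling1_eq_zero_of_lt (by omega : n < m), mul_zero]

theorem mul_stirling1_zero_right (n : ℕ) : n * stirling1 n 0 = 0 := by
  cases n <;> simp [stirling1]

theorem mul_polyCauchy (n k : ℕ) :
    n * polyCauchy n k =
      ∑ m ∈ Finset.range (n + 1), n * stirling1 n (m + 1) * (m + 2) ^ k := by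
  have h : polyCauchy n k =
      ∑ m ∈ Finset.range (n + 2), stirling1 n m * (m + 1) ^ k := by
    rw [Finset.sum_range_succ, stirling1_eq_zero_of_lt n.lt_succ_self, zero_mul, add_zero,
      polyCauchy]
  rw [h, Finset.mul_sum, Finset.sum_range_succ', ← mul_assoc, mul_stirling1_zero_right,
    zero_mul, add_zero]
  exact Finset.sum_congr rfl fun m _ => (mul_assoc _ _ _).symm

theorem sum_choose_mul_polyCauchy (n k : ℕ) :
    ∑ i ∈ Finset.range (k + 1), Nat.choose k i * polyCauchy n (k - i) =
      ∑ m ∈ Finset.range (n + 1), stirling1 n m * (m + 2) ^ k := by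
  simp only [polyCauchy, Finset.mul_sum]
  rw [Finset.sum_comm]
  refine Finset.sum_congr rfl fun m _ => ?_
  rw [show m + 2 = 1 + (m + 1) by ring, add_pow, Finset.mul_sum]
  refine Finset.sum_congr rfl fun i _ => ?_
  rw [one_pow, Nat.cast_id]
  ring

theorem polyCauchy_recurrence (n k : ℕ) (hn : 1 ≤ n) :
    polyCauchy n k = (n - 1) * polyCauchy (n - 1) k
      + ∑ i ∈ Finset.range (k + 1), Nat.choose k i * polyCauchy (n - 1) (k - i) := by
  obtain ⟨n, rfl⟩ := Nat.exists_eq_add_of_le' hn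
  rw [Nat.add_sub_cancel, mul_polyCauchy, sum_choose_mul_polyCauchy, ← Finset.sum_add_distrib,
    polyCauchy, Finset.sum_range_succ']
  simp only [stirling1, zero_mul, add_zero]
  exact Finset.sum_congr rfl fun m _ => add_mul _ _ _
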